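/- Suppose M : ℝ → ℝ is real analytic on all of ℝ and M is not identically zero on [0,∞). Then for every t ≥ 0 there exists an integer l ≥ 1 with h_l(t) ≠ 0, and there exists an integer l ≥ 0 with p_l(t) ≠ 0; that is, for each t ≥ 0 neither the sequence (h_l(t))_{l≥1} nor the sequence (p_l(t))_{l≥0} is identically zero. -/

import Mathlib

open Set MeasureTheory

/-- Convolution on `[0,∞)` (via signed interval integral): `(f*g)(t) = ∫_0^t f(t-s) g(s) ds`. -/
noncomputable def conv (f g : ℝ → ℝ) : ℝ → ℝ :=
  fun t => ∫ s in (0:ℝ)..t, f (t - s) * g s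

/-- `j`-fold convolution power of `M`, with the conventions `M^{*0} = 0` and `M^{*1} = M`. -/
noncomputable def convPow (M : ℝ → ℝ) : ℕ → ℝ → ℝ
  | 0 => fun _ => 0
  | 1 => M
  | (j+2) => conv M (convPow M (j+1))

/-- The norm `‖f‖_{C^k([0,t])} = ∑_{l=0}^k max_{0 ≤ τ ≤ t} |f^{(l)}(τ)|`,
derivatives taken within `[0,∞)`. -/
noncomputable def CkNorm (k : ℕ) (t : ℝ) (f : ℝ → ℝ) : ℝ :=
  ∑ l ∈ Finset.range (k+1), ⨆ τ : Set.Icc (0:ℝ) t, |iteratedDerivWithin l f (Set.Ici 0) τ|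

/-- The coefficient `h_l(t) = (-1)^l ∑_{j=0}^l C(l, l-j) (d^{l-j}/dt^{l-j} M^{*j})(t)`
(derivatives taken within `[0,∞)`; recall the convention `M^{*0} = 0`). -/
noncomputable def hcoef (M : ℝ → ℝ) (l : ℕ) (t : ℝ) : ℝ :=
  (-1 : ℝ) ^ l * ∑ j ∈ Finset.range (l + 1),
    (l.choose (l - j) : ℝ) * iteratedDerivWithin (l - j) (convPow M j) (Set.Ici 0) t

/-- The coefficient
`p_l(t) = −h_l(0) + (-1)^{l+1} ∑_{(m,j)} C(l, l-j+m) ((d^{l-j+m}/dt^{l-j+m}) M^{*j})(0) (-t)^m/m!`,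
where the sum runs over pairs of positive integers `(m,j)` with `2j − l − 1 ≤ m ≤ j`
(equivalently `2j ≤ m + l + 1`; all such pairs satisfy `m ≤ j ≤ l + 1`, and the exponent
`l - j + m` is the natural number `l + m - j ≥ 0`). -/
noncomputable def pcoef (M : ℝ → ℝ) (l : ℕ) (t : ℝ) : ℝ :=
  -hcoef M l 0 + (-1 : ℝ) ^ (l + 1) *
    ∑ j ∈ Finset.Icc 1 (l + 1), ∑ m ∈ Finset.Icc 1 j,
      if 2 * j ≤ m + l + 1 then
        (l.choose (l + m - j) : ℝ) *
          iteratedDerivWithin (l + m - j) (convPow M j) (Set.Ici 0) 0 *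
          ((-t) ^ m / (m.factorial : ℝ))
      else 0


open scoped Topology Nat
open Filter

lemma AnalyticAt.exists_iteratedDeriv_bound {f : ℝ → ℝ} {x : ℝ} (hf : AnalyticAt ℝ f x) :
    ∃ U ∈ 𝓝 x, ∃ C R : ℝ, ∀ y ∈ U, ∀ n : ℕ, |iteratedDeriv n f y| ≤ C * R ^ n * n ! := by
  obtain ⟨p, r, hp⟩ := hf
  obtain ⟨ρ', hρ', hρr⟩ := ENNReal.lt_iff_exists_nnreal_btwn.1 hp.r_pos
  obtain ⟨ρ, hρ0, hρ⟩ : ∃ ρ : NNReal, 0 < ρ ∧ ρ + ρ = ρ' :=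
    ⟨ρ' / 2, half_pos (by exact_mod_cast hρ'), add_halves ρ'⟩
  have hsum : (ρ + ρ : ENNReal) < r := by
    rw [← ENNReal.coe_add, hρ]; exact hρr
  have hS := p.changeOriginSeries_summable_aux₁ (hsum.trans_le hp.r_le)
  set T : NNReal := ∑' s : Σ k l : ℕ, { s : Finset (Fin (k + l)) // s.card = l },
    ‖p (s.1 + s.2.1)‖₊ * ρ ^ s.2.1 * ρ ^ s.1 with hT
  have hTk : ∀ k, (∑' s : Σ l : ℕ, { s : Finset (Fin (k + l)) // s.card = l },
      ‖p (k + s.1)‖₊ * ρ ^ s.1) * ρ ^ k ≤ T := by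
    intro k
    rw [hT, ← NNReal.tsum_mul_right]
    exact NNReal.tsum_comp_le_tsum_of_inj hS
      (i := fun s : Σ l : ℕ, { s : Finset (Fin (k + l)) // s.card = l } => ⟨k, s⟩)
      (fun a b h => by simpa using h)
  refine ⟨Metric.ball x ρ, Metric.ball_mem_nhds x (by exact_mod_cast hρ0), T, (ρ : ℝ)⁻¹,
    fun z hz n => ?_⟩
  obtain ⟨y, rfl⟩ : ∃ y, z = x + y := ⟨z - x, by ring⟩
  have hy : ‖y‖₊ < ρ := by
    rw [← NNReal.coe_lt_coe]; simpa using hz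
  have hyr : (‖y‖₊ : ENNReal) < r :=
    lt_of_lt_of_le (by exact_mod_cast hy) (le_self_add.trans hsum.le)
  have hρp : (ρ : ENNReal) < p.radius := (le_self_add.trans_lt hsum).trans_le hp.r_le
  have hq := hp.changeOrigin hyr
  have hle : ‖p.changeOrigin y n‖₊ * ρ ^ n ≤ T := by
    refine le_trans ?_ (hTk n)
    gcongr
    refine (p.nnnorm_changeOrigin_le n (hyr.trans_le hp.r_le)).trans ?_
    refine Summable.tsum_le_tsum (fun s => ?_)
      (p.changeOriginSeries_summable_aux₂ (hyr.trans_le hp.r_le) n)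
      (p.changeOriginSeries_summable_aux₂ hρp n)
    gcongr
  have hle' : ‖p.changeOrigin y n‖ ≤ T * (ρ : ℝ)⁻¹ ^ n := by
    rw [inv_pow, ← div_eq_mul_inv, le_div_iff₀ (by positivity)]
    exact_mod_cast hle
  have h1 := hq.factorial_smul (1 : ℝ) n
  rw [iteratedDeriv_eq_iteratedFDeriv, ← h1, nsmul_eq_mul, abs_mul, Nat.abs_cast, mul_comm]
  gcongr
  refine le_trans ?_ hle'
  simpa using! (p.changeOrigin y n).le_opNorm (fun _ => 1)

lemma IsCompact.exists_iteratedDeriv_bound {f : ℝ → ℝ} {K : Set ℝ} (hK : IsCompact K)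
    (hf : AnalyticOnNhd ℝ f K) :
    ∃ C R : ℝ, 1 ≤ C ∧ 1 ≤ R ∧
      ∀ y ∈ K, ∀ n : ℕ, |iteratedDeriv n f y| ≤ C * R ^ n * n ! := by
  refine hK.induction_on (p := fun s => ∃ C R : ℝ, 1 ≤ C ∧ 1 ≤ R ∧
      ∀ y ∈ s, ∀ n : ℕ, |iteratedDeriv n f y| ≤ C * R ^ n * n !)
    ⟨1, 1, le_rfl, le_rfl, by simp⟩ ?_ ?_ ?_
  · rintro s t hst ⟨C, R, hC, hR, h⟩
    exact ⟨C, R, hC, hR, fun y hy => h y (hst hy)⟩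
  · rintro s t ⟨C, R, hC, hR, h⟩ ⟨C', R', hC', hR', h'⟩
    refine ⟨max C C', max R R', hC.trans (le_max_left _ _), hR.trans (le_max_left _ _), ?_⟩
    rintro y (hy | hy) n
    · refine (h y hy n).trans ?_
      gcongr
      exacts [le_max_left _ _, le_max_left _ _]
    · refine (h' y hy n).trans ?_
      gcongr
      exacts [le_max_right _ _, le_max_right _ _]
  · intro x hx
    obtain ⟨U, hU, C, R, h⟩ := (hf x hx).exists_iteratedDeriv_bound
    refine ⟨U, mem_nhdsWithin_of_mem_nhds hU, max 1 |C|, max 1 |R|, le_max_left _ _,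
      le_max_left _ _, fun y hy n => (h y hy n).trans ?_⟩
    gcongr ?_ * _
    refine (le_abs_self _).trans ?_
    rw [abs_mul, abs_pow]
    gcongr
    exacts [le_max_right _ _, le_max_right _ _]

lemma hasDerivAt_conv {f f' g : ℝ → ℝ} (hf : ∀ x, HasDerivAt f (f' x) x) (hf' : Continuous f')
    (hg : Continuous g) (x : ℝ) :
    HasDerivAt (conv f g) (f 0 * g x + conv f' g x) x := by
  have hfc : Continuous f := continuous_iff_continuousAt.2 fun x => (hf x).continuousAt
  have hint : ∀ y a b, IntervalIntegrable (fun s => f (y - s) * g s) volume a b := fun y a b =>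
    Continuous.intervalIntegrable (by fun_prop) _ _
  have h1 : HasDerivAt (fun y => ∫ s in (0 : ℝ)..x, f (y - s) * g s) (conv f' g x) x := by
    obtain ⟨B, hB⟩ := ((isCompact_closedBall x 1).prod (isCompact_uIcc (a := (0 : ℝ)) (b := x))
      ).exists_bound_of_continuousOn (f := fun z : ℝ × ℝ => f' (z.1 - z.2) * g z.2)
      (by fun_prop)
    refine (intervalIntegral.hasDerivAt_integral_of_dominated_loc_of_deriv_le
      (F' := fun y s => f' (y - s) * g s) (bound := fun _ => B)
      (Metric.ball_mem_nhds x one_pos) (Eventually.of_forall fun y =>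
        Continuous.aestronglyMeasurable (by fun_prop)) (hint x 0 x)
        (Continuous.aestronglyMeasurable (by fun_prop)) ?_
        intervalIntegrable_const ?_).2
    · refine Eventually.of_forall fun s hs y hy => hB (y, s) ⟨Metric.ball_subset_closedBall hy,
        uIoc_subset_uIcc hs⟩
    · refine Eventually.of_forall fun s hs y hy => ?_
      simpa using (((hf (y - s)).comp y ((hasDerivAt_id y).sub_const s)).mul_const (g s))
  have h2 : HasDerivAt (fun y => ∫ s in x..y, f 0 * g s) (f 0 * g x) x :=
    intervalIntegral.integral_hasDerivAt_right
      (Continuous.intervalIntegrable (by fun_prop) _ _)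
      (Continuous.stronglyMeasurableAtFilter (by fun_prop) _ _) (by fun_prop)
  have h3 : HasDerivAt (fun y => ∫ s in x..y, (f (y - s) - f 0) * g s) 0 x := by
    rw [hasDerivAt_iff_isLittleO, Asymptotics.isLittleO_iff]
    intro ε hε
    have hc : Continuous fun z : ℝ × ℝ => (f (z.1 - z.2) - f 0) * g z.2 := by fun_prop
    obtain ⟨δ, hδ, h⟩ := Metric.continuous_iff.1 hc (x, x) ε hε
    filter_upwards [Metric.ball_mem_nhds x hδ] with y hy
    simp only [intervalIntegral.integral_same, sub_zero, smul_zero]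
    refine intervalIntegral.norm_integral_le_of_norm_le_const fun s hs => ?_
    have hs' : dist s x ≤ dist y x := by
      have := Set.abs_sub_left_of_mem_uIcc (uIoc_subset_uIcc hs)
      simpa [Real.dist_eq] using this
    have := h (y, s) (by
      rw [Prod.dist_eq]; exact max_lt hy (hs'.trans_lt hy))
    simpa using this.le
  have key : conv f g = fun y => (∫ s in (0 : ℝ)..x, f (y - s) * g s) +
      ((∫ s in x..y, f 0 * g s) + ∫ s in x..y, (f (y - s) - f 0) * g s) := by
    funext y
    rw [← intervalIntegral.integral_add (Continuous.intervalIntegrable (by fun_prop) _ _)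
      (Continuous.intervalIntegrable (by fun_prop) _ _), conv,
      ← intervalIntegral.integral_add_adjacent_intervals (hint y 0 x) (hint y x y)]
    congr 2
    funext s
    ring
  rw [key]
  exact (h1.add (h2.add h3)).congr_deriv (by ring)

/-- Given the successive derivatives `d n` of a function, the successive derivatives of its
convolution powers. -/
noncomputable def convPowDeriv (d : ℕ → ℝ → ℝ) : ℕ → ℕ → ℝ → ℝ
  | 0 => fun _ _ => 0
  | 1 => d
  | (j + 2) => fun n x => ∑ i ∈ Finset.range n, d i 0 * convPowDeriv d (j + 1) (n - 1 - i) x +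
      conv (d n) (convPowDeriv d (j + 1) 0) x

lemma convPowDeriv_zero_right (d : ℕ → ℝ → ℝ) : ∀ j, convPowDeriv d j 0 = convPow (d 0) j
  | 0 => rfl
  | 1 => rfl
  | (j + 2) => by
    funext x
    simp [convPowDeriv, convPow, convPowDeriv_zero_right d (j + 1)]

lemma hasDerivAt_convPowDeriv {d : ℕ → ℝ → ℝ} (hd : ∀ n x, HasDerivAt (d n) (d (n + 1) x) x) :
    ∀ j n x, HasDerivAt (convPowDeriv d j n) (convPowDeriv d j (n + 1) x) x
  | 0, _, x => hasDerivAt_const x 0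
  | 1, n, x => hd n x
  | (j + 2), n, x => by
    have ih := hasDerivAt_convPowDeriv hd (j + 1)
    have hc := hasDerivAt_conv (hd n)
      (continuous_iff_continuousAt.2 fun x => (hd (n + 1) x).continuousAt)
      (continuous_iff_continuousAt.2 fun x => (ih 0 x).continuousAt) x
    have hs := HasDerivAt.fun_sum (u := Finset.range n) fun i _ =>
      (ih (n - 1 - i) x).const_mul (d i 0)
    refine (hs.add hc).congr_deriv ?_
    simp only [convPowDeriv, Finset.sum_range_succ]
    rw [add_assoc]
    congr 1
    · refine Finset.sum_congr rfl fun i hi => ?_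
      have := Finset.mem_range.1 hi
      congr 2
      omega
    · simp

lemma iteratedDerivWithin_Ici_eq {F : ℕ → ℝ → ℝ} (hF : ∀ n x, HasDerivAt (F n) (F (n + 1) x) x)
    (n : ℕ) : ∀ x ∈ Ici (0 : ℝ), iteratedDerivWithin n (F 0) (Ici 0) x = F n x := by
  induction n with
  | zero => simp
  | succ n ih =>
    intro x hx
    rw [iteratedDerivWithin_succ, derivWithin_congr ih (ih x hx)]
    exact (hF n x).hasDerivWithinAt.derivWithin (uniqueDiffOn_Ici 0 x hx)

lemma convPowDeriv_bound {d : ℕ → ℝ → ℝ} {a C R : ℝ} (ha : 0 ≤ a) (hC : 1 ≤ C) (hR : 1 ≤ R)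
    (hd : ∀ x, |x| ≤ a → ∀ n, |d n x| ≤ C * R ^ n * n !) :
    ∀ j n x, |x| ≤ a → |convPowDeriv d j n x| ≤ C * (C * (1 + a)) ^ j * R ^ n * n !
  | 0, n, x, _ => by simp only [convPowDeriv, abs_zero]; positivity
  | 1, n, x, hx => by
    refine (hd x hx n).trans ?_
    gcongr
    rw [pow_one]
    nlinarith [mul_nonneg (sub_nonneg.2 hC) ha]
  | (j + 2), n, x, hx => by
    have ih := convPowDeriv_bound ha hC hR hd (j + 1)
    set K := C * (1 + a) with hK
    have h0a : |(0 : ℝ)| ≤ a := by simpa using ha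
    have h1 : |∑ i ∈ Finset.range n, d i 0 * convPowDeriv d (j + 1) (n - 1 - i) x| ≤
        C * (C * K ^ (j + 1) * R ^ n * n !) := by
      have hterm : ∀ i ∈ Finset.range n, |d i 0 * convPowDeriv d (j + 1) (n - 1 - i) x| ≤
          C * (C * K ^ (j + 1)) * R ^ n * (n - 1)! := by
        intro i hi
        have hi := Finset.mem_range.1 hi
        rw [abs_mul]
        calc _ ≤ (C * R ^ i * i !) * (C * K ^ (j + 1) * R ^ (n - 1 - i) * (n - 1 - i)!) := by
              gcongr
              exacts [hd 0 h0a i, ih _ x hx]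
          _ = C * (C * K ^ (j + 1)) * R ^ (i + (n - 1 - i)) * (i ! * (n - 1 - i)! : ℕ) := by
              push_cast; ring
          _ ≤ _ := by
              have h2 : i ! * (n - 1 - i)! ≤ (n - 1)! := by
                have := Nat.factorial_mul_factorial_dvd_factorial_add i (n - 1 - i)
                rw [show i + (n - 1 - i) = n - 1 by omega] at this
                exact Nat.le_of_dvd (Nat.factorial_pos _) this
              gcongr
              omega
      refine (Finset.abs_sum_le_sum_abs _ _).trans ((Finset.sum_le_sum hterm).trans ?_)
      rw [Finset.sum_const, Finset.card_range, nsmul_eq_mul]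
      cases n with
      | zero => simp only [Nat.cast_zero, zero_mul]; positivity
      | succ n =>
        rw [add_tsub_cancel_right, Nat.factorial_succ]
        push_cast
        exact le_of_eq (by ring)
    have h2 : |conv (d n) (convPowDeriv d (j + 1) 0) x| ≤
        C * R ^ n * n ! * (C * K ^ (j + 1)) * a := by
      rw [conv, ← Real.norm_eq_abs]
      refine (intervalIntegral.norm_integral_le_of_norm_le_const
        (C := C * R ^ n * n ! * (C * K ^ (j + 1))) fun s hs => ?_).trans ?_
      · have hs := uIoc_subset_uIcc hs
        have hs1 : |s| ≤ |x| := by simpa using Set.abs_sub_left_of_mem_uIcc hs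
        have hs2 : |x - s| ≤ |x| := by simpa using Set.abs_sub_right_of_mem_uIcc hs
        rw [norm_mul, Real.norm_eq_abs, Real.norm_eq_abs]
        gcongr
        · exact hd _ (hs2.trans hx) n
        · simpa using ih 0 s (hs1.trans hx)
      · rw [sub_zero]
        gcongr
    refine (abs_add_le _ _).trans ((add_le_add h1 h2).trans (le_of_eq ?_))
    rw [pow_succ K (j + 1)]
    nth_rw 3 [hK]
    ring

lemma abs_le_of_forall_deriv_eq_zero {F : ℕ → ℝ → ℝ} {x : ℝ} {s : Set ℝ} (hs : s.OrdConnected)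
    (hx : x ∈ s) (hF : ∀ n, ∀ y ∈ s, HasDerivAt (F n) (F (n + 1) y) y) (hx0 : ∀ n, F n x = 0)
    {B : ℝ} (k : ℕ) :
    ∀ n, ∀ y ∈ s, y ≤ x → (∀ u ∈ Icc y x, |F (n + k) u| ≤ B) →
      |F n y| ≤ B * ((x - y) ^ k / k !) := by
  induction k with
  | zero => intro n y _ hyx h; simpa using h y ⟨le_rfl, hyx⟩
  | succ k ih =>
    intro n y hy hyx h
    have hmem : ∀ r ∈ Icc 0 (x - y), x - r ∈ Icc y x := fun r hr =>
      ⟨by linarith [hr.2], by linarith [hr.1]⟩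
    have hder : ∀ r ∈ Icc 0 (x - y),
        HasDerivAt (fun r => F n (x - r)) (-F (n + 1) (x - r)) r := fun r hr => by
      simpa using! (hF n (x - r) (hs.out hy hx (hmem r hr))).comp r
        ((hasDerivAt_id r).const_sub x)
    have hBd : ∀ r, HasDerivAt (fun r : ℝ => B * (r ^ (k + 1) / (k + 1)!)) (B * (r ^ k / k !)) r := by
      intro r
      refine (((hasDerivAt_pow (k + 1) r).div_const ((k + 1)! : ℝ)).const_mul B).congr_deriv ?_
      rw [Nat.factorial_succ]
      push_cast
      have : (k ! : ℝ) ≠ 0 := by positivity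
      field_simp
    have := image_norm_le_of_norm_deriv_right_le_deriv_boundary
      (f := fun r => F n (x - r)) (a := 0) (b := x - y)
      (fun r hr => (hder r hr).continuousAt.continuousWithinAt)
      (fun r hr => (hder r (Ico_subset_Icc_self hr)).hasDerivWithinAt)
      (by simp [hx0]) hBd
      (fun r hr => by
        have hr := hmem r (Ico_subset_Icc_self hr)
        have := ih (n + 1) (x - r) (hs.out hy hx hr) hr.2 fun u hu => by
          have := h u ⟨hr.1.trans hu.1, hu.2⟩
          rwa [show n + 1 + k = n + (k + 1) by ring]
        simpa using this)
      (right_mem_Icc.2 (sub_nonneg.2 hyx))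
    simpa using this

/-- If all derivatives of a function vanish at a point and grow at most like those of an
analytic function, then they all vanish to the left of this point. -/
lemma eq_zero_of_forall_deriv_eq_zero {F : ℕ → ℝ → ℝ} {t : ℝ} {s : Set ℝ} (hs : s.OrdConnected)
    (ht : t ∈ s) (hF : ∀ n, ∀ y ∈ s, HasDerivAt (F n) (F (n + 1) y) y) {A R : ℝ} (hR : 1 ≤ R)
    (hb : ∀ n, ∀ y ∈ s, |F n y| ≤ A * R ^ n * n !) (ht0 : ∀ n, F n t = 0) :
    ∀ y ∈ s, y ≤ t → ∀ n, F n y = 0 := by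
  have hR0 : 0 < R := one_pos.trans_le hR
  have hA : 0 ≤ A := by simpa using (abs_nonneg _).trans (hb 0 t ht)
  have step : ∀ x ∈ s, (∀ n, F n x = 0) → ∀ y ∈ s, y ≤ x → x - y ≤ 1 / (4 * R) →
      ∀ n, F n y = 0 := by
    intro x hx hx0 y hy hyx hxy n
    have hle : ∀ k : ℕ, |F n y| ≤ A * (2 * R) ^ n * n ! * (1 / 2) ^ k := by
      intro k
      refine (abs_le_of_forall_deriv_eq_zero hs hx hF hx0 k n y hy hyx
        fun u hu => hb _ u (hs.out hy hx hu)).trans ?_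
      have hfac : ((n + k)! : ℝ) ≤ 2 ^ (n + k) * (n ! * k !) := by
        have h1 := Nat.add_choose_mul_factorial_mul_factorial n k
        have h2 := Nat.choose_le_two_pow (n + k) k
        rw [← h1, mul_assoc]
        push_cast
        gcongr
        exact_mod_cast h2
      have hpow : (x - y) ^ k ≤ (1 / (4 * R)) ^ k := by
        have := sub_nonneg.2 hyx
        gcongr
      calc A * R ^ (n + k) * (n + k)! * ((x - y) ^ k / k !)
          ≤ A * R ^ (n + k) * (2 ^ (n + k) * (n ! * k !)) * ((1 / (4 * R)) ^ k / k !) := by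
            have := sub_nonneg.2 hyx
            gcongr
        _ = A * (2 * R) ^ n * n ! * (2 * R * (1 / (4 * R))) ^ k := by
            have : (k ! : ℝ) ≠ 0 := by positivity
            rw [mul_pow (2 * R) _ k, mul_pow, mul_pow, pow_add, pow_add]
            field_simp
        _ = _ := by
            congr 2
            field_simp
            norm_num
    have hlim : Tendsto (fun k : ℕ => A * (2 * R) ^ n * n ! * (1 / 2 : ℝ) ^ k) atTop (𝓝 0) := by
      simpa using (tendsto_pow_atTop_nhds_zero_of_lt_one (r := (1 / 2 : ℝ)) (by norm_num)
        (by norm_num)).const_mul (A * (2 * R) ^ n * n !)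
    exact abs_nonpos_iff.1 (ge_of_tendsto' hlim hle)
  have iter : ∀ m : ℕ, ∀ y ∈ s, y ≤ t → t - y ≤ m * (1 / (4 * R)) → ∀ n, F n y = 0 := by
    intro m
    induction m with
    | zero =>
      intro y _ hyt h
      obtain rfl : y = t := le_antisymm hyt (by simpa using h)
      exact ht0
    | succ m ih =>
      intro y hy hyt h
      push_cast at h
      have hδ : 0 < 1 / (4 * R) := by positivity
      have hmem : min t (y + 1 / (4 * R)) ∈ Icc y t :=
        ⟨le_min hyt (by linarith), min_le_left _ _⟩
      refine step _ (hs.out hy ht hmem) (ih _ (hs.out hy ht hmem) hmem.2 ?_) y hy hmem.1 ?_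
      · rcases min_choice t (y + 1 / (4 * R)) with h' | h' <;> rw [h']
        · rw [sub_self]; positivity
        · linarith
      · linarith [min_le_right t (y + 1 / (4 * R))]
  intro y hy hyt
  obtain ⟨m, hm⟩ := exists_nat_ge ((t - y) / (1 / (4 * R)))
  exact iter m y hy hyt ((div_le_iff₀ (by positivity)).1 hm)

/-- The series `∑_j (x - t)^j / j! * E_{j + q, p}(x)`. -/
noncomputable def shiftedExpSeries (E : ℕ → ℕ → ℝ → ℝ) (t : ℝ) (p q : ℕ) (x : ℝ) : ℝ :=
  ∑' j : ℕ, (x - t) ^ j / j ! * E (j + q) p x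

/-- The successive derivatives of `shiftedExpSeries E t 0 0`. -/
noncomputable def shiftedExpSeriesDeriv (E : ℕ → ℕ → ℝ → ℝ) (t : ℝ) (n : ℕ) (x : ℝ) : ℝ :=
  ∑ ij ∈ Finset.HasAntidiagonal.antidiagonal n,
    (n.choose ij.1 : ℝ) * shiftedExpSeries E t ij.1 ij.2 x

section ShiftedExpSeries

variable {E : ℕ → ℕ → ℝ → ℝ} {a C K R t : ℝ}

lemma shiftedExpSeries_term_le (ht : |t| ≤ a)
    (hb : ∀ j n x, |x| ≤ a → |E j n x| ≤ C * K ^ j * R ^ n * n !) (p q j : ℕ) {x : ℝ}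
    (hx : |x| ≤ a) :
    |(x - t) ^ j / j ! * E (j + q) p x| ≤
      C * K ^ q * R ^ p * p ! * ((2 * a * K) ^ j / j !) := by
  have hxt : |x - t| ≤ 2 * a := (abs_sub _ _).trans (by linarith)
  have ha : 0 ≤ a := (abs_nonneg _).trans hx
  rw [abs_mul, abs_div, abs_pow, Nat.abs_cast]
  calc _ ≤ (2 * a) ^ j / j ! * (C * K ^ (j + q) * R ^ p * p !) := by
        gcongr
        exact hb _ _ x hx
    _ = _ := by rw [mul_pow _ K]; ring

lemma summable_shiftedExpSeries (ht : |t| ≤ a)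
    (hb : ∀ j n x, |x| ≤ a → |E j n x| ≤ C * K ^ j * R ^ n * n !) (p q : ℕ) {x : ℝ}
    (hx : |x| ≤ a) : Summable fun j : ℕ => (x - t) ^ j / j ! * E (j + q) p x :=
  Summable.of_norm_bounded ((Real.summable_pow_div_factorial (2 * a * K)).mul_left _)
    fun j => shiftedExpSeries_term_le ht hb p q j hx

lemma abs_shiftedExpSeries_le (ht : |t| ≤ a)
    (hb : ∀ j n x, |x| ≤ a → |E j n x| ≤ C * K ^ j * R ^ n * n !) (p q : ℕ) {x : ℝ}
    (hx : |x| ≤ a) :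
    |shiftedExpSeries E t p q x| ≤
      C * K ^ q * R ^ p * p ! * ∑' j : ℕ, (2 * a * K) ^ j / (j ! : ℝ) :=
  tsum_of_norm_bounded (f := fun j : ℕ => (x - t) ^ j / j ! * E (j + q) p x)
    ((Real.summable_pow_div_factorial (2 * a * K)).hasSum.mul_left _)
    fun j => shiftedExpSeries_term_le ht hb p q j hx

lemma hasDerivAt_shiftedExpSeries (ht : |t| ≤ a)
    (hb : ∀ j n x, |x| ≤ a → |E j n x| ≤ C * K ^ j * R ^ n * n !)
    (hE : ∀ j n x, HasDerivAt (E j n) (E j (n + 1) x) x) (p q : ℕ) {x : ℝ}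
    (hx : x ∈ Ioo (-a) a) :
    HasDerivAt (shiftedExpSeries E t p q)
      (shiftedExpSeries E t p (q + 1) x + shiftedExpSeries E t (p + 1) q x) x := by
  have habs : ∀ {y}, y ∈ Ioo (-a) a → |y| ≤ a := fun hy => (abs_lt.2 hy).le
  have ha : 0 ≤ a := (abs_nonneg _).trans ht
  have hC : 0 ≤ C := by simpa using (abs_nonneg _).trans (hb 0 0 t ht)
  set e' : ℕ → ℝ → ℝ := fun j y => (j * (y - t) ^ (j - 1)) / j ! with he'
  have hpow : ∀ j y, HasDerivAt (fun y => (y - t) ^ j / (j ! : ℝ)) (e' j y) y := fun j y => by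
    simpa using! (((hasDerivAt_id y).sub_const t).pow j).div_const (j ! : ℝ)
  have he0 : ∀ y, e' 0 y = 0 := fun y => by simp [he']
  have hes : ∀ j y, e' (j + 1) y = (y - t) ^ j / j ! := fun j y => by
    simp only [he', Nat.factorial_succ]
    push_cast
    have : (j ! : ℝ) ≠ 0 := by positivity
    field_simp
  set u : ℕ → ℝ := fun j => Nat.casesOn j 0
    fun j => C * K ^ (q + 1) * R ^ p * p ! * ((2 * a * K) ^ j / j !) with hu
  have hus : Summable u := (summable_nat_add_iff 1).1
    ((Real.summable_pow_div_factorial (2 * a * K)).mul_left _)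
  have hue : ∀ j y, y ∈ Ioo (-a) a → |e' j y * E (j + q) p y| ≤ u j := by
    rintro (_ | j) y hy
    · simp [he0, hu]
    · have := shiftedExpSeries_term_le ht hb p (q + 1) j (habs hy)
      rwa [← hes, ← add_assoc, add_right_comm] at this
  have hsum := hasDerivAt_tsum_of_isPreconnected
    (g := fun j y => (y - t) ^ j / (j ! : ℝ) * E (j + q) p y)
    (g' := fun j y => e' j y * E (j + q) p y + (y - t) ^ j / j ! * E (j + q) (p + 1) y)
    (hus.add ((Real.summable_pow_div_factorial (2 * a * K)).mul_left
      (C * K ^ q * R ^ (p + 1) * (p + 1)!)))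
    isOpen_Ioo isPreconnected_Ioo (fun j y _ => (hpow j y).mul (hE (j + q) p y))
    (fun j y hy => (abs_add_le _ _).trans (add_le_add (hue j y hy)
      (shiftedExpSeries_term_le ht hb (p + 1) q j (habs hy))))
    hx (summable_shiftedExpSeries ht hb p q (habs hx)) hx
  refine hsum.congr_deriv ?_
  have hse : Summable fun j => e' j x * E (j + q) p x :=
    Summable.of_norm_bounded hus fun j => hue j x hx
  rw [hse.tsum_add (summable_shiftedExpSeries ht hb (p + 1) q (habs hx)),
    hse.tsum_eq_zero_add, he0]
  simp only [hes, zero_mul, zero_add, shiftedExpSeries, add_right_comm, add_assoc]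

lemma hasDerivAt_shiftedExpSeriesDeriv (ht : |t| ≤ a)
    (hb : ∀ j n x, |x| ≤ a → |E j n x| ≤ C * K ^ j * R ^ n * n !)
    (hE : ∀ j n x, HasDerivAt (E j n) (E j (n + 1) x) x) (n : ℕ) {x : ℝ}
    (hx : x ∈ Ioo (-a) a) :
    HasDerivAt (shiftedExpSeriesDeriv E t n) (shiftedExpSeriesDeriv E t (n + 1) x) x := by
  refine (HasDerivAt.fun_sum fun ij _ => (hasDerivAt_shiftedExpSeries ht hb hE ij.1 ij.2
    hx).const_mul (n.choose ij.1 : ℝ)).congr_deriv ?_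
  rw [shiftedExpSeriesDeriv, Finset.sum_antidiagonal_choose_succ_mul
    (fun i j => shiftedExpSeries E t i j x), ← Finset.sum_add_distrib]
  refine Finset.sum_congr rfl fun ij hij => ?_
  rw [Nat.choose_symm_of_eq_add (Finset.HasAntidiagonal.mem_antidiagonal.1 hij).symm, mul_add]

lemma abs_shiftedExpSeriesDeriv_le (hK : 1 ≤ K) (hR : 1 ≤ R) (ht : |t| ≤ a)
    (hb : ∀ j n x, |x| ≤ a → |E j n x| ≤ C * K ^ j * R ^ n * n !) (n : ℕ) {x : ℝ}
    (hx : |x| ≤ a) :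
    |shiftedExpSeriesDeriv E t n x| ≤
      (C * ∑' j : ℕ, (2 * a * K) ^ j / (j ! : ℝ)) * (2 * (K * R)) ^ n * n ! := by
  have ha : 0 ≤ a := (abs_nonneg _).trans ht
  have hC : 0 ≤ C := by simpa using (abs_nonneg _).trans (hb 0 0 t ht)
  set T := ∑' j : ℕ, (2 * a * K) ^ j / (j ! : ℝ) with hT
  have hT0 : 0 ≤ T := tsum_nonneg fun j => by positivity
  have hterm : ∀ ij ∈ Finset.HasAntidiagonal.antidiagonal n,
      |(n.choose ij.1 : ℝ) * shiftedExpSeries E t ij.1 ij.2 x| ≤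
        C * T * (K * R) ^ n * n ! := by
    rintro ⟨i, j⟩ hij
    obtain rfl : i + j = n := Finset.HasAntidiagonal.mem_antidiagonal.1 hij
    have hfac : (((i + j).choose i : ℝ)) * i ! ≤ (i + j)! := by
      have h1 := Nat.add_choose_mul_factorial_mul_factorial i j
      rw [← Nat.choose_symm_add] at h1
      exact_mod_cast (Nat.le_mul_of_pos_right _ (Nat.factorial_pos j)).trans h1.le
    rw [abs_mul, Nat.abs_cast]
    calc _ ≤ ((i + j).choose i : ℝ) * (C * K ^ j * R ^ i * i ! * T) := by
          gcongr
          exact abs_shiftedExpSeries_le ht hb i j hx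
      _ = C * T * (K ^ j * R ^ i) * (((i + j).choose i : ℝ) * i !) := by ring
      _ ≤ C * T * (K ^ (i + j) * R ^ (i + j)) * (i + j)! := by
          gcongr
          all_goals first | assumption | omega
      _ = _ := by rw [mul_pow]
  refine (Finset.abs_sum_le_sum_abs _ _).trans ((Finset.sum_le_sum hterm).trans ?_)
  rw [Finset.sum_const, Finset.Nat.card_antidiagonal, nsmul_eq_mul, mul_pow 2]
  have h2 : ((n + 1 : ℕ) : ℝ) ≤ 2 ^ n := by exact_mod_cast Nat.lt_two_pow_self
  calc _ ≤ 2 ^ n * (C * T * (K * R) ^ n * n !) := by gcongr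
    _ = _ := by ring

end ShiftedExpSeries

lemma convPowDeriv_apply_zero_eq_zero {d : ℕ → ℝ → ℝ} {m : ℕ} (hd : ∀ k < m, d k 0 = 0) :
    ∀ j n, n ≤ m → ¬(j = 1 ∧ n = m) → convPowDeriv d j n 0 = 0
  | 0, _, _, _ => rfl
  | 1, n, hn, h => hd n (lt_of_le_of_ne hn fun h' => h ⟨rfl, h'⟩)
  | (j + 2), n, hn, _ => by
    simp only [convPowDeriv, conv, intervalIntegral.integral_same, add_zero]
    refine Finset.sum_eq_zero fun i hi => ?_
    rw [hd i ((Finset.mem_range.1 hi).trans_le hn), zero_mul]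

lemma shiftedExpSeries_self (E : ℕ → ℕ → ℝ → ℝ) (t : ℝ) (p q : ℕ) :
    shiftedExpSeries E t p q t = E q p t := by
  rw [shiftedExpSeries, tsum_eq_single 0 fun j hj => by simp [hj]]
  simp

lemma shiftedExpSeries_convPowDeriv_zero {d : ℕ → ℝ → ℝ} {m : ℕ} (hd : ∀ k < m, d k 0 = 0) (t : ℝ)
    {p q : ℕ} (hpq : p + q = m) :
    shiftedExpSeries (convPowDeriv d) t p q 0 = if p = m then -t * d m 0 else 0 := by
  have hz := convPowDeriv_apply_zero_eq_zero hd
  split_ifs with h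
  · obtain rfl : q = 0 := by omega
    rw [shiftedExpSeries, tsum_eq_single 1 fun j hj => by
      rw [hz (j + 0) p (by omega) (by omega), mul_zero]]
    simp [convPowDeriv, h]
  · refine (tsum_congr fun j => ?_).trans tsum_zero
    rw [hz (j + q) p (by omega) (by omega), mul_zero]

lemma shiftedExpSeriesDeriv_convPowDeriv_zero {d : ℕ → ℝ → ℝ} {m : ℕ} (hd : ∀ k < m, d k 0 = 0)
    (t : ℝ) : shiftedExpSeriesDeriv (convPowDeriv d) t m 0 = -t * d m 0 := by
  rw [shiftedExpSeriesDeriv, Finset.sum_eq_single (m, 0)]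
  · simp [shiftedExpSeries_convPowDeriv_zero hd]
  · rintro ⟨i, j⟩ hij hne
    have hij := Finset.HasAntidiagonal.mem_antidiagonal.1 hij
    have hi : i ≠ m := by
      rintro rfl
      exact hne (by simpa using hij)
    simp [shiftedExpSeries_convPowDeriv_zero hd t hij, hi]
  · simp

lemma hcoef_eq {d : ℕ → ℝ → ℝ} (hd : ∀ n x, HasDerivAt (d n) (d (n + 1) x) x) (l : ℕ) {t : ℝ}
    (ht : 0 ≤ t) :
    hcoef (d 0) l t =
      (-1) ^ l * ∑ j ∈ Finset.range (l + 1), (l.choose (l - j) : ℝ) * convPowDeriv d j (l - j) t := by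
  simp only [hcoef, ← convPowDeriv_zero_right]
  simp only [iteratedDerivWithin_Ici_eq (hasDerivAt_convPowDeriv hd _) _ t ht]

lemma hcoef_eq_shiftedExpSeriesDeriv {d : ℕ → ℝ → ℝ}
    (hd : ∀ n x, HasDerivAt (d n) (d (n + 1) x) x) (l : ℕ) {t : ℝ} (ht : 0 ≤ t) :
    hcoef (d 0) l t = (-1) ^ l * shiftedExpSeriesDeriv (convPowDeriv d) t l t := by
  rw [hcoef_eq hd l ht, shiftedExpSeriesDeriv, ← Finset.Nat.sum_antidiagonal_swap,
    Finset.Nat.sum_antidiagonal_eq_sum_range_succ_mk]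
  simp only [shiftedExpSeries_self, Prod.fst_swap, Prod.snd_swap]

lemma hcoef_zero_of_forall_lt {d : ℕ → ℝ → ℝ} {m : ℕ}
    (hd : ∀ n x, HasDerivAt (d n) (d (n + 1) x) x) (hd0 : ∀ k < m, d k 0 = 0) :
    hcoef (d 0) m 0 = 0 := by
  rw [hcoef_eq hd m le_rfl, Finset.sum_eq_zero, mul_zero]
  intro j hj
  by_cases hj0 : j = 0
  · simp [hj0, convPowDeriv]
  · have := Finset.mem_range.1 hj
    rw [convPowDeriv_apply_zero_eq_zero hd0 j _ (by omega) (by omega), mul_zero]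

lemma hcoef_succ_zero_of_forall_lt {d : ℕ → ℝ → ℝ} {m : ℕ}
    (hd : ∀ n x, HasDerivAt (d n) (d (n + 1) x) x) (hd0 : ∀ k < m, d k 0 = 0) :
    hcoef (d 0) (m + 1) 0 = (-1) ^ (m + 1) * ((m + 1) * d m 0) := by
  rw [hcoef_eq hd _ le_rfl, Finset.sum_eq_single 1]
  · simp [convPowDeriv]
  · intro j hj hj1
    by_cases hj0 : j = 0
    · simp [hj0, convPowDeriv]
    · have := Finset.mem_range.1 hj
      rw [convPowDeriv_apply_zero_eq_zero hd0 j _ (by omega) (by omega), mul_zero]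
  · simp

lemma pcoef_apply_zero (M : ℝ → ℝ) (l : ℕ) : pcoef M l 0 = -hcoef M l 0 := by
  rw [pcoef, add_eq_left, Finset.sum_eq_zero, mul_zero]
  refine fun j _ => Finset.sum_eq_zero fun m hm => ?_
  have : m ≠ 0 := by have := Finset.mem_Icc.1 hm; omega
  simp [this]

lemma pcoef_of_forall_lt {d : ℕ → ℝ → ℝ} {m : ℕ}
    (hd : ∀ n x, HasDerivAt (d n) (d (n + 1) x) x) (hd0 : ∀ k < m, d k 0 = 0) (t : ℝ) :
    pcoef (d 0) m t = (-1) ^ (m + 1) * (d m 0 * -t) := by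
  rw [pcoef, hcoef_zero_of_forall_lt hd hd0, neg_zero, zero_add, Finset.sum_eq_single 1]
  · have h := iteratedDerivWithin_Ici_eq hd m 0 self_mem_Ici
    simp [convPow, h]
  · intro j hj hj1
    refine Finset.sum_eq_zero fun i hi => ?_
    have hj := Finset.mem_Icc.1 hj
    have hi := Finset.mem_Icc.1 hi
    rw [← convPowDeriv_zero_right,
      iteratedDerivWithin_Ici_eq (hasDerivAt_convPowDeriv hd _) _ 0 self_mem_Ici,
      convPowDeriv_apply_zero_eq_zero hd0 j _ (by omega) (by omega)]
    simp
  · simp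

lemma exists_hcoef_ne_zero_of_pos {M : ℝ → ℝ} (hM : AnalyticOnNhd ℝ M univ)
    (hd : ∀ n x, HasDerivAt (iteratedDeriv n M) (iteratedDeriv (n + 1) M x) x) {m : ℕ}
    (hm0 : ∀ k < m, iteratedDeriv k M 0 = 0) (hm : iteratedDeriv m M 0 ≠ 0) {t : ℝ} (ht : 0 < t) :
    ∃ l : ℕ, 1 ≤ l ∧ hcoef M l t ≠ 0 := by
  by_contra! h
  set d : ℕ → ℝ → ℝ := fun n => iteratedDeriv n M
  have hd00 : d 0 = M := iteratedDeriv_zero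
  have ha : 0 ≤ t + 1 := by linarith
  obtain ⟨C, R, hC, hR, hbd⟩ := (isCompact_Icc (a := -(t + 1)) (b := t + 1)
    ).exists_iteratedDeriv_bound (hM.mono (subset_univ _))
  have hb := convPowDeriv_bound (d := d) ha hC hR fun x hx n => hbd x (abs_le.1 hx) n
  have hE := hasDerivAt_convPowDeriv hd
  have hK : 1 ≤ C * (1 + (t + 1)) := by nlinarith
  have hta : |t| ≤ t + 1 := by rw [abs_of_pos ht]; linarith
  have hF0 : ∀ n, shiftedExpSeriesDeriv (convPowDeriv d) t n t = 0 := by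
    intro n
    rcases Nat.eq_zero_or_pos n with rfl | hn
    · simp [shiftedExpSeriesDeriv, shiftedExpSeries_self, convPowDeriv]
    · have := h n hn
      rw [← hd00, hcoef_eq_shiftedExpSeriesDeriv hd n ht.le] at this
      simpa using this
  have := eq_zero_of_forall_deriv_eq_zero (s := Ioo (-(t + 1)) (t + 1)) ordConnected_Ioo
    ⟨by linarith, by linarith⟩
    (fun n y hy => hasDerivAt_shiftedExpSeriesDeriv hta hb hE n hy)
    (R := 2 * (C * (1 + (t + 1)) * R)) (by nlinarith [one_le_mul_of_one_le_of_one_le hK hR])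
    (fun n y hy => abs_shiftedExpSeriesDeriv_le hK hR hta hb n (abs_lt.2 hy).le) hF0
    0 ⟨by linarith, by linarith⟩ ht.le m
  rw [shiftedExpSeriesDeriv_convPowDeriv_zero hm0] at this
  exact mul_ne_zero (neg_ne_zero.2 ht.ne') hm this

/-- non-triviality of the coefficient sequences.  If `M` is real analytic on
`ℝ` and not identically zero on `[0,∞)`, then for every `t ≥ 0` there is `l ≥ 1` with
`h_l(t) ≠ 0` and there is `l ≥ 0` with `p_l(t) ≠ 0`. -/
theorem hcoef_pcoef_nontrivial
    (M : ℝ → ℝ) (hM : AnalyticOnNhd ℝ M Set.univ)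
    (hM0 : ∃ t : ℝ, 0 ≤ t ∧ M t ≠ 0) :
    ∀ t : ℝ, 0 ≤ t →
      (∃ l : ℕ, 1 ≤ l ∧ hcoef M l t ≠ 0) ∧ (∃ l : ℕ, pcoef M l t ≠ 0) := by
  have hd : ∀ n x, HasDerivAt (iteratedDeriv n M) (iteratedDeriv (n + 1) M x) x := fun n x => by
    rw [iteratedDeriv_succ]
    exact ((hM.contDiff (n := ⊤)).differentiable_iteratedDeriv n
      (WithTop.coe_lt_top _) x).hasDerivAt
  obtain ⟨m, hm0, hm⟩ :
      ∃ m, (∀ k < m, iteratedDeriv k M 0 = 0) ∧ iteratedDeriv m M 0 ≠ 0 := by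
    have hne : analyticOrderAt M 0 ≠ ⊤ := fun htop => by
      obtain ⟨t, -, ht⟩ := hM0
      exact ht (hM.eqOn_zero_of_preconnected_of_eventuallyEq_zero isPreconnected_univ
        (mem_univ 0) (analyticOrderAt_eq_top.1 htop) (mem_univ t))
    obtain ⟨m, hm⟩ := ENat.ne_top_iff_exists.1 hne
    exact ⟨m, (analyticOrderAt_eq_nat_iff_iteratedDeriv_eq_zero (hM 0 (mem_univ 0))).1 hm.symm⟩
  have hh := hcoef_succ_zero_of_forall_lt hd hm0
  have hp := pcoef_of_forall_lt hd hm0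
  rw [iteratedDeriv_zero] at hh hp
  have hh0 : hcoef M (m + 1) 0 ≠ 0 := by
    rw [hh]
    have : (m + 1 : ℝ) ≠ 0 := by positivity
    simp [hm, this]
  intro t ht
  rcases ht.eq_or_lt with rfl | ht
  · exact ⟨⟨m + 1, by omega, hh0⟩, m + 1, by rwa [pcoef_apply_zero, neg_ne_zero]⟩
  · refine ⟨exists_hcoef_ne_zero_of_pos hM hd hm0 hm ht, m, ?_⟩
    rw [hp]
    simp [hm, ht.ne']
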